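/- Let m be a positive integer and Λ ⊂ ℕ^m with combinatorial dimension d = dim(Λ), and let Γ_Λ be the associated set of multi-indices. Then there is a constant C_Λ > 0 such that for every continuous m-homogeneous polynomial P : c₀ → ℂ, (∑_{α∈Γ_Λ} |c_α(P)|^{2m/(m+1)})^{(m+1)/(2m)} ≤ e^d (C_Λ · m · m!)^{d/m} (2/√π)^{(m-1)d/m} ‖P‖. -/

import Mathlib

open Filter Topology

noncomputable section

/-- The space `c₀` of complex null sequences. -/
abbrev c0 : Type := ZeroAtInftyContinuousMap ℕ ℂ

/-- The canonical unit vectors of `c₀`. -/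
def e (i : ℕ) : c0 :=
  { toFun := Pi.single i 1
    continuous_toFun := continuous_of_discreteTopology
    zero_at_infty' := by
      refine Filter.Tendsto.congr' ?_ tendsto_const_nhds
      filter_upwards [Filter.mem_cocompact.mpr ⟨{i}, isCompact_singleton, subset_rfl⟩] with x hx
      simp only [Set.mem_compl_iff, Set.mem_singleton_iff] at hx
      simp [Pi.single_eq_of_ne hx] }

/-- A continuous `m`-linear form on `c₀`. -/
abbrev MForm (m : ℕ) : Type := ContinuousMultilinearMap ℂ (fun _ : Fin m => c0) ℂ

/-- `T` is symmetric. -/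
def IsSymmForm {m : ℕ} (T : MForm m) : Prop :=
  ∀ (σ : Equiv.Perm (Fin m)) (v : Fin m → c0), T (fun k => v (σ k)) = T v

/-- The norm of the `m`-homogeneous polynomial associated to `T`:
`‖P‖ = sup_{x ∈ B_{c₀}} |P x|` where `P x = T (x, …, x)`. -/
def polyNorm {m : ℕ} (T : MForm m) : ℝ :=
  ⨆ x : Metric.closedBall (0 : c0) 1, ‖T (fun _ => (x : c0))‖

/-- Multiplicity of `i` in the index tuple `j`. -/
def mult {m : ℕ} (j : Fin m → ℕ) (i : ℕ) : ℕ :=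
  (Finset.univ.filter fun k => j k = i).card

/-- The coefficient of the monomial associated to the (monotone) index tuple `j`
of the `m`-homogeneous polynomial with symmetric multilinear form `T`:
`c_α(P) = (m!/(α_{i₁}!⋯α_{i_M}!)) ⬝ T(e_{j 1}, …, e_{j m})`. -/
def coeff {m : ℕ} (T : MForm m) (j : Fin m → ℕ) : ℂ :=
  ((Nat.factorial m / ∏ i ∈ Finset.univ.image j, Nat.factorial (mult j i) : ℕ) : ℂ)
    * T (fun k => e (j k))

/-- `ψ_Λ(n)`. -/
def psi {m : ℕ} (Λ : Set (Fin m → ℕ)) (n : ℕ) : ℕ :=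
  sSup {c : ℕ | ∃ A : Fin m → Finset ℕ, (∀ i, (A i).card ≤ n) ∧
    c = ({f | ∀ i, f i ∈ A i} ∩ Λ).ncard}

/-- The combinatorial dimension of `Λ ⊆ ℕ^m`. -/
def combDim {m : ℕ} (Λ : Set (Fin m → ℕ)) : ℝ :=
  Filter.atTop.limsup fun n : ℕ => Real.log (psi Λ n) / Real.log n

end

noncomputable def sg (b : Bool) : ℂ := if b then 1 else -1

lemma norm_sg (b : Bool) : ‖sg b‖ = 1 := by cases b <;> simp [sg]

lemma sum_cons_bool {N : ℕ} (F : (Fin (N+1) → Bool) → ℝ) :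
    ∑ ε, F ε = ∑ δ : Fin N → Bool, (F (Fin.cons true δ) + F (Fin.cons false δ)) := by
  rw [← (Fin.consEquiv (fun _ => Bool)).sum_comp, Fintype.sum_prod_type]
  simp [Fin.consEquiv, Finset.sum_add_distrib]

section kh
variable {H : Type*} [NormedAddCommGroup H] [InnerProductSpace ℂ H]

lemma pair_sq (x b : H) : ‖b + x‖ ^ 2 + ‖-b + x‖ ^ 2 = 2 * (‖b‖ ^ 2 + ‖x‖ ^ 2) := by
  have h1 := norm_add_sq (𝕜 := ℂ) b x
  have h2 := norm_add_sq (𝕜 := ℂ) (-b) x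
  simp only [inner_neg_left, map_neg, norm_neg] at h2
  linarith

lemma pair_four (x b : H) : ‖b + x‖ ^ 4 + ‖-b + x‖ ^ 4 ≤
    2 * (‖b‖ ^ 4 + 6 * ‖b‖ ^ 2 * ‖x‖ ^ 2 + ‖x‖ ^ 4) := by
  have h1 := norm_add_sq (𝕜 := ℂ) b x
  have h2 := norm_add_sq (𝕜 := ℂ) (-b) x
  simp only [inner_neg_left, map_neg, norm_neg] at h2
  have h3 : |RCLike.re (inner ℂ b x)| ≤ ‖b‖ * ‖x‖ :=
    (RCLike.abs_re_le_norm _).trans (norm_inner_le_norm b x)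
  have h4 : (RCLike.re (inner ℂ b x)) ^ 2 ≤ (‖b‖ * ‖x‖) ^ 2 := by
    rw [← sq_abs]; gcongr
  have e1 : ‖b + x‖ ^ 4 = (‖b + x‖ ^ 2) ^ 2 := by ring
  have e2 : ‖-b + x‖ ^ 4 = (‖-b + x‖ ^ 2) ^ 2 := by ring
  rw [e1, e2, h1, h2]
  nlinarith

lemma moment_two (N : ℕ) (a : Fin N → H) :
    ∑ ε : Fin N → Bool, ‖∑ i, sg (ε i) • a i‖ ^ 2 = 2 ^ N * ∑ i, ‖a i‖ ^ 2 := by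
  induction N with
  | zero => simp
  | succ N ih =>
    rw [sum_cons_bool]
    simp only [Fin.sum_univ_succ, Fin.cons_zero, Fin.cons_succ]
    simp only [sg, if_true, Bool.false_eq_true, if_false, one_smul, neg_smul, pair_sq]
    rw [← Finset.mul_sum, Finset.sum_add_distrib]
    have := ih (fun i => a i.succ)
    simp only [sg] at this
    simp only [ite_smul, one_smul, neg_smul] at this ⊢
    rw [this]
    simp
    ring

lemma moment_four (N : ℕ) (a : Fin N → H) :
    ∑ ε : Fin N → Bool, ‖∑ i, sg (ε i) • a i‖ ^ 4 ≤ 2 ^ N * (3 * (∑ i, ‖a i‖ ^ 2) ^ 2) := by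
  induction N with
  | zero => simp
  | succ N ih =>
    rw [sum_cons_bool]
    have h4 := ih (fun i => a i.succ)
    have h2 := moment_two N (fun i => a i.succ)
    simp only [Fin.sum_univ_succ, Fin.cons_zero, Fin.cons_succ]
    have key : ∀ δ : Fin N → Bool,
        ‖sg true • a 0 + ∑ i, sg (δ i) • a i.succ‖ ^ 4 +
        ‖sg false • a 0 + ∑ i, sg (δ i) • a i.succ‖ ^ 4 ≤
        2 * ‖a 0‖ ^ 4 + 12 * ‖a 0‖ ^ 2 * ‖∑ i, sg (δ i) • a i.succ‖ ^ 2
          + 2 * ‖∑ i, sg (δ i) • a i.succ‖ ^ 4 := by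
      intro δ
      have := pair_four (∑ i, sg (δ i) • a i.succ) (a 0)
      have s1 : sg true = 1 := by simp [sg]
      have s2 : sg false = -1 := by simp [sg]
      rw [s1, s2, one_smul, neg_one_smul]
      linarith
    refine (Finset.sum_le_sum (fun δ _ => key δ)).trans ?_
    rw [Finset.sum_add_distrib, Finset.sum_add_distrib, ← Finset.mul_sum, ← Finset.mul_sum,
      ← Finset.mul_sum, h2]
    set S := ∑ i : Fin N, ‖a i.succ‖ ^ 2
    have hc : ∑ _δ : Fin N → Bool, ‖a 0‖ ^ 4 = 2 ^ N * ‖a 0‖ ^ 4 := by simp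
    rw [hc, pow_succ (2:ℝ) N]
    have hp : (0:ℝ) < 2 ^ N := by positivity
    have h5 : 0 ≤ 2 ^ N * ‖a 0‖ ^ 4 := by positivity
    have h6 : 2 ^ N * 2 * (3 * (‖a 0‖ ^ 2 + S) ^ 2) = 6 * (2 ^ N * ‖a 0‖ ^ 4)
      + 12 * ‖a 0‖ ^ 2 * (2 ^ N * S) + 2 * (2 ^ N * (3 * S ^ 2)) := by ring
    rw [h6]
    linarith

lemma khin_aux {t c : ℝ} (ht : 0 ≤ t) (hc : 0 ≤ c) : 3 * c ^ 2 * t ^ 2 - t ^ 4 ≤ 2 * c ^ 3 * t := by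
  have : 0 ≤ t * (t - c) ^ 2 * (t + 2 * c) := by positivity
  nlinarith

lemma khinchine (N : ℕ) (a : Fin N → H) :
    2 ^ N * Real.sqrt (∑ i, ‖a i‖ ^ 2) ≤ 2 * ∑ ε : Fin N → Bool, ‖∑ i, sg (ε i) • a i‖ := by
  set s := Real.sqrt (∑ i, ‖a i‖ ^ 2) with hs
  have hS : 0 ≤ ∑ i, ‖a i‖ ^ 2 := by positivity
  have hss : s ^ 2 = ∑ i, ‖a i‖ ^ 2 := Real.sq_sqrt hS
  have hs0 : 0 ≤ s := Real.sqrt_nonneg _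
  have h2 := moment_two N a
  have h4 := moment_four N a
  rw [← hss] at h2 h4
  have h1 : ∑ ε : Fin N → Bool, (3 * (2 * s) ^ 2 * ‖∑ i, sg (ε i) • a i‖ ^ 2
      - ‖∑ i, sg (ε i) • a i‖ ^ 4) ≤ ∑ ε : Fin N → Bool, 2 * (2 * s) ^ 3 * ‖∑ i, sg (ε i) • a i‖ :=
    Finset.sum_le_sum fun ε _ => khin_aux (norm_nonneg _) (by positivity)
  rw [Finset.sum_sub_distrib, ← Finset.mul_sum, ← Finset.mul_sum, h2] at h1
  set E := ∑ ε : Fin N → Bool, ‖∑ i, sg (ε i) • a i‖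
  have hE : 0 ≤ E := by positivity
  rcases hs0.eq_or_lt with h | h
  · rw [← h]; simpa using hE
  · have hp : (0:ℝ) < 2 ^ N := by positivity
    have : s ^ 3 * (9 * (2 ^ N * s)) ≤ s ^ 3 * (16 * E) := by nlinarith
    have := le_of_mul_le_mul_left this (by positivity)
    have : 0 ≤ 2 ^ N * s := by positivity
    linarith
end kh

lemma sum_cons_gen {X M : Type*} [Fintype X] [AddCommMonoid M] {m : ℕ} (F : (Fin (m+1) → X) → M) :
    ∑ ε, F ε = ∑ x : X, ∑ δ : Fin m → X, F (Fin.cons x δ) := by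
  rw [← (Fin.consEquiv (fun _ => X)).sum_comp, Fintype.sum_prod_type]
  simp [Fin.consEquiv]

lemma multi_khinchine (N : ℕ) (m : ℕ) (a : (Fin m → Fin N) → ℂ) :
    (2 ^ N) ^ m * Real.sqrt (∑ g, ‖a g‖ ^ 2) ≤
      2 ^ m * ∑ ε : Fin m → (Fin N → Bool), ‖∑ g, (∏ i, sg (ε i (g i))) * a g‖ := by
  induction m with
  | zero => simp [Real.sqrt_sq]
  | succ m ih =>
    let b : Fin N → EuclideanSpace ℂ (Fin m → Fin N) :=
      fun l => WithLp.toLp 2 (fun g => a (Fin.cons l g))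
    have h := khinchine N b
    have hb : ∑ g, ‖a g‖ ^ 2 = ∑ i, ‖b i‖ ^ 2 := by
      rw [sum_cons_gen]
      refine Finset.sum_congr rfl fun l _ => ?_
      rw [EuclideanSpace.norm_sq_eq]
    rw [hb, sum_cons_gen]
    have h3 : ∀ ε : Fin N → Bool, (2 ^ N) ^ m * ‖∑ i, sg (ε i) • b i‖ ≤
        2 ^ m * ∑ δ : Fin m → (Fin N → Bool), ‖∑ g : Fin (m+1) → Fin N,
          (∏ i, sg ((Fin.cons ε δ : Fin (m+1) → (Fin N → Bool)) i (g i))) * a g‖ := by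
      intro ε
      have := ih (fun g => ∑ l, sg (ε l) * a (Fin.cons l g))
      rw [EuclideanSpace.norm_eq]
      convert this using 4 with g _ δ _
      · simp [b]
      · rw [sum_cons_gen, Finset.sum_comm]
        refine Finset.sum_congr rfl fun g _ => ?_
        rw [Finset.mul_sum]
        refine Finset.sum_congr rfl fun l _ => ?_
        rw [Fin.prod_univ_succ]
        simp only [Fin.cons_zero, Fin.cons_succ]
        ring
    have h5 := Finset.sum_le_sum (fun (ε : Fin N → Bool) (_ : ε ∈ Finset.univ) => h3 ε)
    rw [← Finset.mul_sum, ← Finset.mul_sum] at h5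
    calc (2 ^ N) ^ (m + 1) * Real.sqrt (∑ i, ‖b i‖ ^ 2)
        = (2 ^ N) ^ m * (2 ^ N * Real.sqrt (∑ i, ‖b i‖ ^ 2)) := by ring
      _ ≤ (2 ^ N) ^ m * (2 * ∑ ε : Fin N → Bool, ‖∑ i, sg (ε i) • b i‖) := by gcongr
      _ = 2 * ((2 ^ N) ^ m * ∑ ε : Fin N → Bool, ‖∑ i, sg (ε i) • b i‖) := by ring
      _ ≤ 2 * (2 ^ m * _) := by gcongr
      _ = _ := by ring

lemma e_apply (i j : ℕ) : (e i) j = if j = i then 1 else 0 := by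
  show (Pi.single i 1 : ℕ → ℂ) j = _
  rw [Pi.single_apply]

lemma c0_norm_le {x : c0} {C : ℝ} (hC : 0 ≤ C) (h : ∀ n, ‖x n‖ ≤ C) : ‖x‖ ≤ C := by
  rw [← ZeroAtInftyContinuousMap.norm_toBCF_eq_norm]
  exact (BoundedContinuousFunction.norm_le hC).2 h

lemma c0_apply_le (x : c0) (n : ℕ) : ‖x n‖ ≤ ‖x‖ := by
  rw [← ZeroAtInftyContinuousMap.norm_toBCF_eq_norm]
  exact x.toBCF.norm_coe_le_norm n

/-- evaluation at a coordinate -/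
noncomputable def evalC0 (n : ℕ) : c0 →L[ℂ] ℂ :=
  LinearMap.mkContinuous
    { toFun := fun x => x n
      map_add' := fun _ _ => rfl
      map_smul' := fun _ _ => rfl } 1 (fun x => by simpa using c0_apply_le x n)

lemma evalC0_apply (n : ℕ) (x : c0) : evalC0 n x = x n := rfl

/-- truncation -/
noncomputable def truncC0 (N : ℕ) : c0 →L[ℂ] c0 :=
  ∑ i ∈ Finset.range N, (evalC0 i).smulRight (e i)

lemma truncC0_e (N j : ℕ) : truncC0 N (e j) = if j < N then e j else 0 := by
  simp [truncC0, evalC0_apply, e_apply]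

lemma norm_comb_le {N : ℕ} (c : Fin N → ℂ) (hc : ∀ l, ‖c l‖ ≤ 1) :
    ‖∑ l : Fin N, c l • e (l : ℕ)‖ ≤ 1 := by
  refine c0_norm_le zero_le_one fun n => ?_
  rw [← evalC0_apply, map_sum]
  simp only [map_smul, evalC0_apply, e_apply, smul_eq_mul, mul_ite, mul_one, mul_zero]
  by_cases h : n < N
  · rw [Finset.sum_eq_single (⟨n, h⟩ : Fin N)]
    · simpa using hc _
    · intro b _ hb
      rw [if_neg]
      rintro rfl
      exact hb rfl
    · simp
  · rw [Finset.sum_eq_zero]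
    · simp
    · intro l _
      rw [if_neg]
      have := l.2
      omega

lemma poly_bdd {m : ℕ} (T : MForm m) :
    BddAbove (Set.range fun x : Metric.closedBall (0 : c0) 1 => ‖T (fun _ => (x : c0))‖) := by
  refine ⟨‖T‖, ?_⟩
  rintro _ ⟨x, rfl⟩
  have hx : ‖(x : c0)‖ ≤ 1 := mem_closedBall_zero_iff.1 x.2
  refine (T.le_opNorm _).trans ?_
  simp only [Finset.prod_const]
  exact mul_le_of_le_one_right (norm_nonneg _) (pow_le_one₀ (norm_nonneg _) hx)

lemma poly_le {m : ℕ} (T : MForm m) (x : c0) (hx : ‖x‖ ≤ 1) :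
    ‖T (fun _ => x)‖ ≤ polyNorm T :=
  le_ciSup (poly_bdd T) (⟨x, by simpa using hx⟩ : Metric.closedBall (0 : c0) 1)

lemma polyNorm_nonneg {m : ℕ} (T : MForm m) : 0 ≤ polyNorm T :=
  (norm_nonneg _).trans (poly_le T 0 (by simp))

lemma poly_le_scaled {m : ℕ} (T : MForm m) (x : c0) {r : ℝ} (hr : 0 < r) (hx : ‖x‖ ≤ r) :
    ‖T (fun _ => x)‖ ≤ r ^ m * polyNorm T := by
  have h := poly_le T (((r⁻¹ : ℝ) : ℂ) • x) (by
    rw [norm_smul, Complex.norm_real, Real.norm_of_nonneg (by positivity)]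
    rw [inv_mul_le_iff₀ hr]; simpa using hx)
  rw [T.map_smul_univ (fun _ => ((r⁻¹ : ℝ) : ℂ)) (fun _ => x)] at h
  simp only [Finset.prod_const, Finset.card_univ, Fintype.card_fin, norm_smul, norm_pow,
    Complex.norm_real, Real.norm_of_nonneg (inv_nonneg.2 hr.le)] at h
  rw [inv_pow, inv_mul_le_iff₀ (by positivity)] at h
  exact h

lemma signs_total {m : ℕ} (f : Fin m → Fin m) :
    ∑ ε : Fin m → Bool, (∏ i, sg (ε i)) * ∏ k, sg (ε (f k)) =
      if Function.Bijective f then 2 ^ m else 0 := by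
  have hs : ∀ b, sg b * sg b = 1 := by intro b; cases b <;> simp [sg]
  split_ifs with hf
  · have : ∀ ε : Fin m → Bool, (∏ i, sg (ε i)) * ∏ k, sg (ε (f k)) = 1 := by
      intro ε
      rw [hf.prod_comp (fun i => sg (ε i)), ← Finset.prod_mul_distrib]
      simp [hs]
    simp [this]
  · have hns : ¬ Function.Surjective f := fun h => hf (Finite.surjective_iff_bijective.1 h)
    simp only [Function.Surjective, not_forall, not_exists] at hns
    obtain ⟨i0, hi0⟩ := hns
    have : ∀ ε : Fin m → Bool, (∏ i, sg (ε i)) * ∏ k, sg (ε (f k)) =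
        ∏ i, (sg (ε i) * ∏ k with f k = i, sg (ε i)) := by
      intro ε
      rw [Finset.prod_mul_distrib]
      congr 1
      rw [← Finset.prod_fiberwise' Finset.univ f (fun i => sg (ε i))]
    simp only [this]
    rw [← Fintype.piFinset_univ,
      ← Finset.prod_univ_sum (fun _ => Finset.univ) (fun i b => sg b * ∏ k with f k = i, sg b)]
    refine Finset.prod_eq_zero (Finset.mem_univ i0) ?_
    have : (Finset.univ.filter fun k => f k = i0) = ∅ := by
      ext k; simp [hi0 k]
    simp [this, sg]

lemma polarization {m : ℕ} (hm : 1 ≤ m) (T : MForm m) (hT : IsSymmForm T) (x : Fin m → c0)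
    (hx : ∀ i, ‖x i‖ ≤ 1) : ‖T x‖ ≤ (m : ℝ) ^ m * polyNorm T := by
  classical
  have hexp : ∀ ε : Fin m → Bool, T (fun _ => ∑ i, sg (ε i) • x i) =
      ∑ f : Fin m → Fin m, (∏ k, sg (ε (f k))) * T (fun k => x (f k)) := by
    intro ε
    rw [T.map_sum (fun _ i => sg (ε i) • x i)]
    refine Finset.sum_congr rfl fun f _ => ?_
    rw [T.map_smul_univ (fun k => sg (ε (f k))) (fun k => x (f k)), smul_eq_mul]
  have h1 : ∑ ε : Fin m → Bool, (∏ i, sg (ε i)) * T (fun _ => ∑ i, sg (ε i) • x i) =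
      2 ^ m * ((Finset.univ.filter fun f : Fin m → Fin m => Function.Bijective f).card * T x) := by
    simp only [hexp, Finset.mul_sum]
    rw [Finset.sum_comm]
    simp only [← mul_assoc, ← Finset.sum_mul, signs_total]
    simp only [ite_mul, zero_mul]
    rw [← Finset.sum_filter, Finset.sum_congr rfl (g := fun _ => 2 ^ m * T x)]
    · simp; ring
    · intro f hf
      simp only [Finset.mem_filter, Finset.mem_univ, true_and] at hf
      rw [← hT (Equiv.ofBijective f hf) x]
      rfl
  have hcard : 1 ≤ (Finset.univ.filter fun f : Fin m → Fin m => Function.Bijective f).card :=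
    Finset.card_pos.2 ⟨id, Finset.mem_filter.2 ⟨Finset.mem_univ _, Function.bijective_id⟩⟩
  have h2 : ‖∑ ε : Fin m → Bool, (∏ i, sg (ε i)) * T (fun _ => ∑ i, sg (ε i) • x i)‖ ≤
      2 ^ m * ((m : ℝ) ^ m * polyNorm T) := by
    refine (norm_sum_le _ _).trans ?_
    have : ∀ ε ∈ (Finset.univ : Finset (Fin m → Bool)),
        ‖(∏ i, sg (ε i)) * T (fun _ => ∑ i, sg (ε i) • x i)‖ ≤ (m : ℝ) ^ m * polyNorm T := by
      intro ε _
      rw [norm_mul, norm_prod]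
      simp only [norm_sg, Finset.prod_const_one, one_mul]
      refine poly_le_scaled T _ (by exact_mod_cast hm) ?_
      refine (norm_sum_le _ _).trans ?_
      have : ∀ i ∈ (Finset.univ : Finset (Fin m)), ‖sg (ε i) • x i‖ ≤ 1 := by
        intro i _
        rw [norm_smul, norm_sg, one_mul]; exact hx i
      refine (Finset.sum_le_sum this).trans ?_
      simp
    refine (Finset.sum_le_sum this).trans ?_
    simp
  rw [h1, norm_mul, norm_mul] at h2
  simp only [norm_pow, Complex.norm_natCast, Complex.norm_ofNat] at h2
  have h3 := le_of_mul_le_mul_left h2 (by positivity)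
  refine le_trans ?_ h3
  exact le_mul_of_one_le_left (norm_nonneg _) (by exact_mod_cast hcard)

/-- expansion of the form on sign-like combinations -/
lemma expand {m N : ℕ} (T : MForm m) (c : Fin m → Fin N → ℂ) :
    T (fun i => ∑ l : Fin N, c i l • e (l : ℕ)) =
      ∑ j : Fin m → Fin N, (∏ i, c i (j i)) * T (fun i => e (j i : ℕ)) := by
  rw [T.map_sum (fun i (l : Fin N) => c i l • e (l : ℕ))]
  refine Finset.sum_congr rfl fun f _ => ?_
  rw [T.map_smul_univ (fun k => c k (f k)) (fun k => e (f k : ℕ)), smul_eq_mul]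

lemma exists_phase (z : ℂ) : ∃ w : ℂ, ‖w‖ ≤ 1 ∧ w * z = (‖z‖ : ℂ) := by
  by_cases h : z = 0
  · exact ⟨0, by simp, by simp [h]⟩
  · have hz : (‖z‖ : ℂ) ≠ 0 := by simpa using h
    refine ⟨(‖z‖ : ℂ) / z, ?_, ?_⟩
    · rw [norm_div, Complex.norm_real, norm_norm, div_self (by simpa using h)]
    · field_simp

lemma mixed {m N : ℕ} (T : MForm (m+1)) (k : Fin (m+1)) (B : ℝ)
    (hB : ∀ x : Fin (m+1) → c0, (∀ i, ‖x i‖ ≤ 1) → ‖T x‖ ≤ B) :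
    ∑ n : Fin N, Real.sqrt (∑ g : Fin m → Fin N,
      ‖T (fun i => e ((k.insertNth n g : Fin (m+1) → Fin N) i : ℕ))‖ ^ 2) ≤ 2 ^ m * B := by
  have h1 : ∀ n : Fin N, _ := fun n => multi_khinchine N m
    (fun g => T (fun i => e ((k.insertNth n g : Fin (m+1) → Fin N) i : ℕ)))
  have h2 : ∀ ε : Fin m → Fin N → Bool, ∑ n : Fin N, ‖∑ g : Fin m → Fin N,
      (∏ i, sg (ε i (g i))) * T (fun i => e ((k.insertNth n g : Fin (m+1) → Fin N) i : ℕ))‖ ≤ B := by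
    intro ε
    choose w hw1 hw2 using fun n : Fin N => exists_phase (∑ g : Fin m → Fin N,
      (∏ i, sg (ε i (g i))) * T (fun i => e ((k.insertNth n g : Fin (m+1) → Fin N) i : ℕ)))
    let c : Fin (m+1) → Fin N → ℂ := k.insertNth w (fun i l => sg (ε i l))
    have hc : ∀ i l, ‖c i l‖ ≤ 1 := by
      intro i
      refine Fin.succAboveCases k ?_ ?_ i
      · intro l; simpa [c] using hw1 l
      · intro i l; simp [c, norm_sg]
    have h3 := hB (fun i => ∑ l : Fin N, c i l • e (l : ℕ)) (fun i => norm_comb_le _ (hc i))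
    rw [expand, ← (Fin.insertNthEquiv (fun _ => Fin N) k).sum_comp, Fintype.sum_prod_type] at h3
    have h4 : ∀ n : Fin N, ∑ g : Fin m → Fin N,
        (∏ i, c i ((Fin.insertNthEquiv (fun _ => Fin N) k) (n, g) i)) *
          T (fun i => e ((Fin.insertNthEquiv (fun _ => Fin N) k) (n, g) i : ℕ)) =
        ((‖∑ g : Fin m → Fin N, (∏ i, sg (ε i (g i))) *
          T (fun i => e ((k.insertNth n g : Fin (m+1) → Fin N) i : ℕ))‖ : ℝ) : ℂ) := by
      intro n
      rw [← hw2, Finset.mul_sum]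
      refine Finset.sum_congr rfl fun g _ => ?_
      rw [Fin.prod_univ_succAbove _ k]
      simp [c, Fin.insertNthEquiv, mul_assoc]
    simp only [h4] at h3
    rw [← Complex.ofReal_sum, Complex.norm_real, Real.norm_of_nonneg (by positivity)] at h3
    exact h3
  have h5 := Finset.sum_le_sum (fun (n : Fin N) (_ : n ∈ Finset.univ) => h1 n)
  rw [← Finset.mul_sum, ← Finset.mul_sum, Finset.sum_comm] at h5
  have h6 := Finset.sum_le_sum (fun (ε : Fin m → Fin N → Bool) (_ : ε ∈ Finset.univ) => h2 ε)
  have h7 : ∑ _ε : Fin m → Fin N → Bool, B = (2 ^ N) ^ m * B := by simp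
  rw [h7] at h6
  have hp : (0:ℝ) < (2 ^ N) ^ m := by positivity
  refine le_of_mul_le_mul_left (h5.trans ?_) hp
  calc _ ≤ 2 ^ m * ((2 ^ N) ^ m * B) := by gcongr
    _ = _ := by ring

lemma psi_le {m : ℕ} (Λ : Set (Fin m → ℕ)) (n : ℕ) : psi Λ n ≤ n ^ m := by
  refine csSup_le' ?_
  rintro c ⟨A, hA, rfl⟩
  have h1 : {f : Fin m → ℕ | ∀ i, f i ∈ A i} = ↑(Fintype.piFinset A) := by
    ext f; simp
  rw [h1]
  refine (Set.ncard_le_ncard Set.inter_subset_left (Finset.finite_toSet _)).trans ?_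
  rw [Set.ncard_coe_finset, Fintype.card_piFinset]
  refine (Finset.prod_le_pow_card _ _ n fun i _ => hA i).trans ?_
  simp

lemma ratio_nonneg {m : ℕ} (Λ : Set (Fin m → ℕ)) (n : ℕ) :
    0 ≤ Real.log (psi Λ n) / Real.log n :=
  div_nonneg (Real.log_natCast_nonneg _) (Real.log_natCast_nonneg _)

lemma ratio_le {m : ℕ} (Λ : Set (Fin m → ℕ)) (n : ℕ) (hn : 2 ≤ n) :
    Real.log (psi Λ n) / Real.log n ≤ m := by
  have hl : 0 < Real.log n := Real.log_pos (by exact_mod_cast hn)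
  rw [div_le_iff₀ hl]
  rcases Nat.eq_zero_or_pos (psi Λ n) with h | h
  · rw [h]; simp; positivity
  · rw [← Real.log_pow]
    exact Real.log_le_log (by exact_mod_cast h) (by exact_mod_cast psi_le Λ n)

lemma combDim_nonneg {m : ℕ} (Λ : Set (Fin m → ℕ)) : 0 ≤ combDim Λ := by
  refine Filter.le_limsup_of_frequently_le (Filter.Frequently.of_forall (ratio_nonneg Λ)) ?_
  exact ⟨m, Filter.eventually_map.2 <| by
    filter_upwards [Filter.eventually_ge_atTop 2] with n hn using ratio_le Λ n hn⟩

lemma combDim_le {m : ℕ} (Λ : Set (Fin m → ℕ)) : combDim Λ ≤ m := by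
  refine Filter.limsup_le_of_le ?_ ?_
  · exact Filter.isCoboundedUnder_le_of_le _ (x := 0) (ratio_nonneg Λ)
  · filter_upwards [Filter.eventually_ge_atTop 2] with n hn using ratio_le Λ n hn

/-- truncated form -/
noncomputable def truncForm {m : ℕ} (T : MForm m) (N : ℕ) : MForm m :=
  T.compContinuousLinearMap (fun _ => truncC0 N)

lemma truncForm_e {m : ℕ} (T : MForm m) (N : ℕ) (j : Fin m → ℕ) :
    truncForm T N (fun i => e (j i)) = if ∀ i, j i < N then T (fun i => e (j i)) else 0 := by
  simp only [truncForm, ContinuousMultilinearMap.compContinuousLinearMap_apply, truncC0_e]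
  split_ifs with h
  · simp [h]
  · push Not at h
    obtain ⟨i, hi⟩ := h
    exact T.map_coord_zero i (by simp [hi])

lemma mixed_tsum {m N : ℕ} (T : MForm (m+1)) (k : Fin (m+1)) (B : ℝ)
    (hB : ∀ x : Fin (m+1) → c0, (∀ i, ‖x i‖ ≤ 1) → ‖T x‖ ≤ B) :
    ∑' n : ℕ, (∑' g : {g : Fin (m+1) → ℕ // g k = n},
            ‖truncForm T N (fun i => e (g.1 i))‖ ^ 2) ^ ((1 : ℝ)/2) ≤ 2 ^ m * B := by
  refine le_trans (le_of_eq ?_) (mixed (N := N) T k B hB)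
  rw [← Function.Injective.tsum_eq (g := (Fin.val : Fin N → ℕ)) Fin.val_injective, tsum_fintype]
  · refine Finset.sum_congr rfl fun n _ => ?_
    rw [Real.sqrt_eq_rpow]
    congr 1
    let φ : (Fin m → Fin N) → {g : Fin (m+1) → ℕ // g k = n} := fun g =>
      ⟨fun i => ((k.insertNth n g : Fin (m+1) → Fin N) i : ℕ), by simp⟩
    have hφ : Function.Injective φ := by
      intro g g' h
      funext i
      have := congrFun (congrArg Subtype.val h) (k.succAbove i)
      simpa [φ, Fin.val_inj] using this
    rw [← hφ.tsum_eq, tsum_fintype]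
    · refine Finset.sum_congr rfl fun g _ => ?_
      rw [truncForm_e, if_pos]
      intro i
      exact Fin.is_lt _
    · rintro ⟨g, hg⟩ hs
      rw [Function.mem_support, truncForm_e] at hs
      have hlt : ∀ i, g i < N := by
        by_contra h
        simp [h] at hs
      refine ⟨fun i => ⟨g (k.succAbove i), hlt _⟩, ?_⟩
      apply Subtype.ext
      funext i
      refine Fin.succAboveCases k ?_ ?_ i
      · simp [φ, hg]
      · intro i; simp [φ]
  · intro n hn
    by_contra h
    apply hn
    have hN : N ≤ n := by
      by_contra h'
      exact h ⟨⟨n, by omega⟩, rfl⟩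
    have : ∀ g : {g : Fin (m+1) → ℕ // g k = n},
        ‖truncForm T N (fun i => e (g.1 i))‖ ^ 2 = 0 := by
      rintro ⟨g, hg⟩
      rw [truncForm_e, if_neg]
      · simp
      · intro h'
        have h2 : g k < N := h' k
        omega
    simp [this]

lemma sum_trunc_le {m : ℕ} (Λ : Set (Fin m → ℕ)) (T : MForm m) (N : ℕ) (q : ℝ) (hq : 0 < q)
    (S : Finset Λ) (hS : ∀ j ∈ S, ∀ i, j.1 i < N) :
    ∑ j ∈ S, ‖T (fun i => e (j.1 i))‖ ^ q ≤
      ∑' j : Λ, ‖truncForm T N (fun i => e (j.1 i))‖ ^ q := by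
  have hfin : (Function.support fun j : Λ => ‖truncForm T N (fun i => e (j.1 i))‖ ^ q).Finite := by
    refine Set.Finite.subset (Set.Finite.preimage (f := (Subtype.val : Λ → (Fin m → ℕ)))
      Subtype.val_injective.injOn
      (Finset.finite_toSet (Fintype.piFinset fun _ : Fin m => Finset.range N))) ?_
    intro j hj
    rw [Function.mem_support, truncForm_e] at hj
    have hlt : ∀ i, j.1 i < N := by
      by_contra h
      simp [h, hq.ne'] at hj
    simpa using hlt
  refine le_trans (le_of_eq ?_)
    ((summable_of_hasFiniteSupport hfin).sum_le_tsum S fun j _ => by positivity)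
  refine Finset.sum_congr rfl fun j hj => ?_
  rw [truncForm_e, if_pos (hS j hj)]

lemma lp_mono {ι : Type*} (S : Finset ι) (a : ι → ℝ) (ha : ∀ i, 0 ≤ a i) {p q M : ℝ} (hq : 0 < q)
    (hqp : q ≤ p) (hM : 0 ≤ M) (h : ∑ i ∈ S, a i ^ q ≤ M ^ q) : ∑ i ∈ S, a i ^ p ≤ M ^ p := by
  have h1 : ∀ i ∈ S, a i ≤ M := by
    intro i hi
    have : a i ^ q ≤ M ^ q :=
      (Finset.single_le_sum (f := fun i => a i ^ q)
        (fun i _ => Real.rpow_nonneg (ha i) q) hi).trans h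
    exact (Real.rpow_le_rpow_iff (ha i) hM hq).1 this
  have h2 : ∀ i ∈ S, a i ^ p ≤ a i ^ q * M ^ (p - q) := by
    intro i hi
    have : p = q + (p - q) := by ring
    conv_lhs => rw [this]
    rw [Real.rpow_add_of_nonneg (ha i) hq.le (by linarith)]
    have := Real.rpow_nonneg (ha i) q
    gcongr
    · exact ha i
    · exact h1 i hi
  refine (Finset.sum_le_sum h2).trans ?_
  rw [← Finset.sum_mul]
  have h3 : M ^ p = M ^ q * M ^ (p - q) := by
    rw [← Real.rpow_add_of_nonneg hM hq.le (by linarith)]; congr 1; ring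
  rw [h3]
  have := Real.rpow_nonneg hM (p - q)
  gcongr

lemma coeff_le {m : ℕ} (T : MForm m) (j : Fin m → ℕ) :
    ‖coeff T j‖ ≤ Nat.factorial m * ‖T (fun i => e (j i))‖ := by
  rw [coeff, norm_mul, Complex.norm_natCast]
  gcongr
  exact Nat.div_le_self _ _

lemma bound_of_bayart (m : ℕ) (Λ : Set (Fin (m+1) → ℕ)) (d C : ℝ) (hd : 0 < d)
    (hdm : d ≤ (m + 1 : ℕ)) (hC : 0 < C)
    (hBayart : ∀ T : MForm (m+1),
      (∑' j : Λ, ‖T (fun i => e (j.1 i))‖ ^ (2 * d / (1 + d))) ^ ((1 + d) / (2 * d))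
        ≤ C * ∑ k : Fin (m+1), ∑' n : ℕ, (∑' g : {g : Fin (m+1) → ℕ // g k = n},
            ‖T (fun i => e (g.1 i))‖ ^ 2) ^ ((1 : ℝ)/2)) :
    ∃ K > (0:ℝ), ∀ T : MForm (m+1), IsSymmForm T →
      (∑' j : {j : Fin (m+1) → ℕ // j ∈ Λ ∧ Monotone j},
          ‖coeff T j.1‖ ^ (2 * ((m+1 : ℕ) : ℝ) / (((m+1 : ℕ) : ℝ) + 1) : ℝ)) ^
            ((((m+1 : ℕ) : ℝ) + 1) / (2 * ((m+1 : ℕ) : ℝ)) : ℝ) ≤ K * polyNorm T := by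
  set r : ℝ := ((m+1 : ℕ) : ℝ) with hr
  have hr1 : 1 ≤ r := by rw [hr]; exact_mod_cast Nat.succ_le_succ (Nat.zero_le m)
  set q : ℝ := 2 * d / (1 + d) with hq
  set p : ℝ := 2 * r / (r + 1) with hp
  have hq0 : 0 < q := by positivity
  have hp0 : 0 < p := by positivity
  have hqp : q ≤ p := by
    rw [hq, hp, div_le_div_iff₀ (by positivity) (by positivity)]
    nlinarith
  have hqi : (1 + d) / (2 * d) = q⁻¹ := by rw [hq, inv_div]
  have hpi : (r + 1) / (2 * r) = p⁻¹ := by rw [hp, inv_div]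
  rw [hqi] at hBayart
  rw [hpi]
  refine ⟨(Nat.factorial (m+1)) * (C * (r * (2 ^ m * r ^ (m+1)))), by positivity, ?_⟩
  intro T hT
  have hP := polyNorm_nonneg T
  set M : ℝ := C * (r * (2 ^ m * (r ^ (m+1) * polyNorm T))) with hM
  have hM0 : 0 ≤ M := by positivity
  have main : ∀ S : Finset Λ, ∑ j ∈ S, ‖T (fun i => e (j.1 i))‖ ^ p ≤ M ^ p := by
    intro S
    refine lp_mono S _ (fun _ => norm_nonneg _) hq0 hqp hM0 ?_
    let N : ℕ := S.sup (fun j => Finset.univ.sup j.1) + 1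
    have hN : ∀ j ∈ S, ∀ i, j.1 i < N := by
      intro j hj i
      have h1 : j.1 i ≤ Finset.univ.sup j.1 := Finset.le_sup (f := j.1) (Finset.mem_univ i)
      have h2 := Finset.le_sup (f := fun j : Λ => Finset.univ.sup j.1) hj
      exact Nat.lt_succ_of_le (h1.trans h2)
    refine (sum_trunc_le Λ T N q hq0 S hN).trans ?_
    have h1 := hBayart (truncForm T N)
    have h2 : C * ∑ k : Fin (m+1), ∑' n : ℕ, (∑' g : {g : Fin (m+1) → ℕ // g k = n},
            ‖truncForm T N (fun i => e (g.1 i))‖ ^ 2) ^ ((1 : ℝ)/2) ≤ M := by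
      rw [hM]
      gcongr
      refine (Finset.sum_le_sum fun k _ => mixed_tsum T k (r ^ (m+1) * polyNorm T) ?_).trans ?_
      · intro x hx
        exact polarization (Nat.succ_le_succ (Nat.zero_le m)) T hT x hx
      · simp [hr]
    exact (Real.rpow_inv_le_iff_of_pos (tsum_nonneg fun _ => by positivity) hM0 hq0).1 (h1.trans h2)
  rw [Real.rpow_inv_le_iff_of_pos (tsum_nonneg fun _ => by positivity) (by positivity) hp0]
  refine Real.tsum_le_of_sum_le (fun _ => by positivity) fun S => ?_
  have h3 := main (S.map ⟨fun j => ⟨j.1, j.2.1⟩, fun a b h => by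
    exact Subtype.ext (Subtype.mk.inj h)⟩)
  rw [Finset.sum_map] at h3
  calc ∑ j ∈ S, ‖coeff T j.1‖ ^ p
      ≤ ∑ j ∈ S, (Nat.factorial (m+1) : ℝ) ^ p * ‖T (fun i => e (j.1 i))‖ ^ p := by
        refine Finset.sum_le_sum fun j _ => ?_
        rw [← Real.mul_rpow (by positivity) (by positivity)]
        exact Real.rpow_le_rpow (norm_nonneg _) (coeff_le T j.1) hp0.le
    _ ≤ (Nat.factorial (m+1) : ℝ) ^ p * M ^ p := by
        rw [← Finset.mul_sum]
        gcongr
        exact h3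
    _ = _ := by
        rw [← Real.mul_rpow (by positivity) hM0, hM]
        congr 1
        ring

/-- the main theorem.  `Λ ⊆ ℕ^m` is closed under permutations
(identification of monomials with index tuples), `Γ_Λ` is realized as the set
of monotone tuples of `Λ`, and Bayart's theorem is assumed as a black box. -/
theorem stmt6 (m : ℕ) (hm : 1 ≤ m) (Λ : Set (Fin m → ℕ))
    (hperm : ∀ j ∈ Λ, ∀ σ : Equiv.Perm (Fin m), (fun k => j (σ k)) ∈ Λ)
    (hBayart : ∃ CΛ > (0 : ℝ), ∀ T : MForm m,
      (∑' j : Λ, ‖T (fun i => e (j.1 i))‖ ^ (2 * combDim Λ / (1 + combDim Λ)))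
          ^ ((1 + combDim Λ) / (2 * combDim Λ))
        ≤ CΛ * ∑ k : Fin m, ∑' n : ℕ, (∑' g : {g : Fin m → ℕ // g k = n},
            ‖T (fun i => e (g.1 i))‖ ^ 2) ^ ((1 : ℝ)/2)) :
    ∃ CΛ > (0 : ℝ), ∀ T : MForm m, IsSymmForm T →
      (∑' j : {j : Fin m → ℕ // j ∈ Λ ∧ Monotone j},
          ‖coeff T j.1‖ ^ (2 * m / (m + 1) : ℝ)) ^ ((m + 1) / (2 * m) : ℝ)
        ≤ Real.exp 1 ^ combDim Λ
            * (CΛ * m * Nat.factorial m) ^ (combDim Λ / m)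
            * (2 / Real.sqrt Real.pi) ^ ((m - 1 : ℝ) * combDim Λ / m)
            * polyNorm T := by
  obtain ⟨C, hC, hB⟩ := hBayart
  have hd0 := combDim_nonneg Λ
  have hdm := combDim_le Λ
  -- in dimension zero the assumed inequality is contradictory
  have hd : 0 < combDim Λ := by
    rcases hd0.eq_or_lt with h | h
    · exfalso
      have h1 := hB 0
      rw [← h] at h1
      simp at h1
      linarith
    · exact h
  obtain ⟨n, rfl⟩ : ∃ n, m = n + 1 := ⟨m - 1, by omega⟩
  obtain ⟨K, hK, hmain⟩ := bound_of_bayart n Λ (combDim Λ) C hd hdm hC hB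
  set d := combDim Λ
  have hr1 : (1 : ℝ) ≤ ((n + 1 : ℕ) : ℝ) := by exact_mod_cast hm
  set r : ℝ := ((n + 1 : ℕ) : ℝ)
  refine ⟨K ^ (r / d), Real.rpow_pos_of_pos hK _, fun T hT => (hmain T hT).trans ?_⟩
  have hP := polyNorm_nonneg T
  refine mul_le_mul_of_nonneg_right ?_ hP
  have hf : (1 : ℝ) ≤ (Nat.factorial (n + 1) : ℝ) := by
    exact_mod_cast Nat.succ_le_of_lt (Nat.factorial_pos _)
  have h1 : 1 ≤ Real.exp 1 ^ d := Real.one_le_rpow (Real.one_le_exp (by norm_num)) hd.le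
  have h2 : 1 ≤ (2 / Real.sqrt Real.pi) ^ ((r - 1) * d / r) := by
    refine Real.one_le_rpow ?_ ?_
    · rw [one_le_div (Real.sqrt_pos.2 Real.pi_pos)]
      rw [Real.sqrt_le_left (by norm_num)]
      nlinarith [Real.pi_le_four]
    · have : 0 ≤ r - 1 := by linarith
      positivity
  have h3 : K ≤ (K ^ (r / d) * r * (Nat.factorial (n + 1) : ℝ)) ^ (d / r) := by
    have hk := Real.rpow_pos_of_pos hK (r / d)
    calc K = (K ^ (r / d)) ^ (d / r) := by
          rw [← Real.rpow_mul hK.le]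
          have : r / d * (d / r) = 1 := by field_simp
          rw [this, Real.rpow_one]
      _ ≤ _ := by
          refine Real.rpow_le_rpow hk.le ?_ (by positivity)
          rw [mul_assoc]
          refine le_mul_of_one_le_right hk.le ?_
          nlinarith
  calc K = 1 * K * 1 := by ring
    _ ≤ _ := by gcongr
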